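/- arXiv:math/0305236 — 3 statements merged into one kernel-verified Lean document; each statement's English description precedes it below -/
import Mathlib

section
/- Let p ≥ 1 and 1 ≤ s ≤ p be integers and let B be a multiset of s positive integers with sum p. For a subset Q of ℤ/pℤ with |Q| = s and for q ∈ Q, define the gap g(q) as the least integer k with 1 ≤ k ≤ p and q + k ∈ Q. Then the number of subsets Q of ℤ/pℤ with |Q| = s whose multiset of gaps {g(q) : q ∈ Q} equals B is p · (s−1)! / ∏_v (m_v!), where m_v denotes the multiplicity of the value v in B. -/
open Finset in
/-- The number of orderings of a multiset, times the product of the factorials of its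
multiplicities, is the factorial of its cardinality. -/
theorem Multiset.card_lists_toFinset_mul_prod_factorial {α : Type*} [DecidableEq α]
    (B : Multiset α) :
    #B.lists.toFinset * ∏ v ∈ B.toFinset, (B.count v).factorial = B.card.factorial := by
  induction hn : B.card generalizing B with
  | zero =>
    obtain rfl := Multiset.card_eq_zero.mp hn
    have : (Multiset.lists (0 : Multiset α)).toFinset = {[]} := by
      ext l
      simp [Multiset.mem_lists_iff, eq_comm]
    simp [this]
  | succ n ih =>
    have hunion : B.lists.toFinset =
        B.toFinset.biUnion fun a => (B.erase a).lists.toFinset.image (List.cons a) := by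
      ext l
      simp only [Multiset.mem_toFinset, Multiset.mem_lists_iff, mem_biUnion, mem_image]
      constructor
      · rintro rfl
        cases l with
        | nil => simp at hn
        | cons a l => exact ⟨a, by simp, l, by simp, rfl⟩
      · rintro ⟨a, ha, l, hl, rfl⟩
        exact (Multiset.cons_erase ha).symm.trans (congrArg (a ::ₘ ·) hl)
    have hcard : #B.lists.toFinset = ∑ a ∈ B.toFinset, #(B.erase a).lists.toFinset := by
      rw [hunion, card_biUnion]
      · exact sum_congr rfl fun a _ => card_image_of_injective _ List.cons_injective
      · intro a _ b _ hab
        rw [Function.onFun, Finset.disjoint_left]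
        simp only [mem_image]
        rintro _ ⟨l, _, rfl⟩ ⟨l', _, h⟩
        exact hab (List.cons.inj h).1.symm
    have hprod : ∀ a ∈ B.toFinset, ∏ v ∈ B.toFinset, (B.count v).factorial =
        B.count a * ∏ v ∈ (B.erase a).toFinset, ((B.erase a).count v).factorial := by
      intro a ha
      have hsub : (B.erase a).toFinset ⊆ B.toFinset :=
        Multiset.toFinset_subset.mpr (Multiset.erase_subset a B)
      rw [prod_subset hsub (by
        intro v _ hv
        rw [Multiset.mem_toFinset] at hv
        simp [Multiset.count_eq_zero_of_notMem hv]),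
        ← mul_prod_erase _ _ ha, ← mul_prod_erase _ _ ha, ← mul_assoc,
        Multiset.count_erase_self, Nat.mul_factorial_pred]
      · congr 1
        refine prod_congr rfl fun v hv => ?_
        rw [Multiset.count_erase_of_ne (ne_of_mem_erase hv)]
      · simpa using ha
    rw [hcard, sum_mul]
    calc _ = ∑ a ∈ B.toFinset, B.count a * n.factorial := by
          refine sum_congr rfl fun a ha => ?_
          rw [hprod a ha, ← ih (B.erase a) (by
            rw [Multiset.card_erase_of_mem (Multiset.mem_toFinset.mp ha), hn]; rfl)]
          ring
      _ = _ := by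
          rw [← sum_mul, Multiset.toFinset_sum_count_eq, hn, Nat.factorial_succ]

/-- The boundaries of a composition are its partial sums. -/
theorem Composition.mem_boundaries_iff {n : ℕ} (c : Composition n) (k : Fin (n + 1)) :
    k ∈ c.boundaries ↔ ∃ i, c.sizeUpTo i = k := by
  simp only [Composition.boundaries, Finset.mem_map, Finset.mem_univ, true_and]
  constructor
  · rintro ⟨i, rfl⟩
    exact ⟨i, rfl⟩
  · rintro ⟨i, hi⟩
    rcases le_total i c.length with h | h
    · exact ⟨⟨i, by lia⟩, Fin.ext hi⟩
    · refine ⟨Fin.last _, Fin.ext ?_⟩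
      rw [← hi, c.sizeUpTo_ofLength_le i h]
      simp

theorem Composition.eq_of_sizeUpTo {n : ℕ} {c d : Composition n}
    (h : ∀ k ≤ n, (∃ i, c.sizeUpTo i = k) ↔ ∃ i, d.sizeUpTo i = k) : c = d := by
  apply (compositionEquiv n).injective
  ext1
  ext k
  exact (c.mem_boundaries_iff k).trans
    ((h k (Nat.lt_succ_iff.mp k.2)).trans (d.mem_boundaries_iff k).symm)

theorem Composition.exists_sizeUpTo {n : ℕ} (P : ℕ → Prop) (h0 : P 0) (hn : P n) :
    ∃ c : Composition n, ∀ k ≤ n, P k ↔ ∃ i, c.sizeUpTo i = k := by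
  classical
  let s : CompositionAsSet n :=
    ⟨Finset.univ.filter fun k => P k, by simpa using h0, by simpa using hn⟩
  refine ⟨s.toComposition, fun k hk => ?_⟩
  have := s.toComposition.mem_boundaries_iff ⟨k, by lia⟩
  rw [s.toComposition_boundaries] at this
  simpa [s] using this

theorem Composition.sizeUpTo_lt {n : ℕ} (c : Composition n) {i j : ℕ} (hij : i < j)
    (hi : i < c.length) : c.sizeUpTo i < c.sizeUpTo j :=
  (c.sizeUpTo_strict_mono hi).trans_le (c.monotone_sizeUpTo hij)

/-- The finset of `ZMod n` reached from `x` by the partial sums of a composition of `n`. -/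
def Composition.cyclicSet {n : ℕ} [NeZero n] (c : Composition n) (x : ZMod n) :
    Finset (ZMod n) :=
  Finset.univ.image fun i : Fin c.length => x + (c.sizeUpTo i : ZMod n)

theorem Composition.natCast_sizeUpTo_injective {n : ℕ} (c : Composition n) (x : ZMod n) :
    Function.Injective fun i : Fin c.length => x + (c.sizeUpTo i : ZMod n) := by
  intro i j h
  have hlt (i : Fin c.length) : c.sizeUpTo i < n := by
    simpa using c.sizeUpTo_lt i.2 i.2
  have h := (ZMod.natCast_eq_natCast_iff' _ _ _).mp (add_left_cancel h)
  rw [Nat.mod_eq_of_lt (hlt i), Nat.mod_eq_of_lt (hlt j)] at h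
  rcases lt_trichotomy i j with hij | hij | hij
  · exact absurd h (c.sizeUpTo_lt hij i.2).ne
  · exact hij
  · exact absurd h (c.sizeUpTo_lt hij j.2).ne'

theorem Composition.add_mem_cyclicSet {n : ℕ} [NeZero n] (c : Composition n) (x : ZMod n)
    {k : ℕ} (hk : k ≤ n) : x + (k : ZMod n) ∈ c.cyclicSet x ↔ ∃ i, c.sizeUpTo i = k := by
  have hn : 0 < n := Nat.pos_of_neZero n
  have hlen : 0 < c.length := by simpa using hn
  simp only [Composition.cyclicSet, Finset.mem_image, Finset.mem_univ, true_and, add_right_inj]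
  constructor
  · rintro ⟨i, hi⟩
    rcases hk.lt_or_eq with hk | rfl
    · refine ⟨i, ?_⟩
      have hlt : c.sizeUpTo i < n := by
        simpa using c.sizeUpTo_lt i.2 i.2
      have h := (ZMod.natCast_eq_natCast_iff' _ _ _).mp hi
      rwa [Nat.mod_eq_of_lt hlt, Nat.mod_eq_of_lt hk] at h
    · exact ⟨_, c.sizeUpTo_length⟩
  · rintro ⟨i, rfl⟩
    by_cases hi : i < c.length
    · exact ⟨⟨i, hi⟩, rfl⟩
    · refine ⟨⟨0, hlen⟩, ?_⟩
      rw [c.sizeUpTo_ofLength_le i (not_lt.mp hi)]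
      simp

theorem Composition.sInf_gap_cyclicSet {n : ℕ} [NeZero n] (c : Composition n) (x : ZMod n)
    (i : Fin c.length) :
    sInf {k : ℕ | 1 ≤ k ∧ k ≤ n ∧ x + (c.sizeUpTo i : ZMod n) + (k : ZMod n) ∈ c.cyclicSet x} =
      c.blocksFun i := by
  have hsucc := c.sizeUpTo_succ' i
  have hle := c.sizeUpTo_le (i + 1)
  refine IsLeast.csInf_eq ⟨⟨c.one_le_blocksFun i, c.blocksFun_le i, ?_⟩, ?_⟩
  · rw [add_assoc, ← Nat.cast_add, ← hsucc, c.add_mem_cyclicSet x hle]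
    exact ⟨_, rfl⟩
  · rintro k ⟨hk, -, hmem⟩
    by_contra! hlt
    rw [add_assoc, ← Nat.cast_add, c.add_mem_cyclicSet x (by lia)] at hmem
    obtain ⟨j, hj⟩ := hmem
    rcases Nat.lt_or_ge i j with hij | hij
    · have := c.monotone_sizeUpTo (Nat.succ_le_of_lt hij)
      simp only [Nat.succ_eq_add_one] at this
      lia
    · have := c.monotone_sizeUpTo hij
      lia

theorem Composition.map_gap_cyclicSet {n : ℕ} [NeZero n] (c : Composition n) (x : ZMod n) :
    (c.cyclicSet x).val.map
      (fun q => sInf {k : ℕ | 1 ≤ k ∧ k ≤ n ∧ q + (k : ZMod n) ∈ c.cyclicSet x}) = c.blocks := by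
  have hval : (c.cyclicSet x).val =
      (Finset.univ : Finset (Fin c.length)).val.map
        fun i : Fin c.length => x + (c.sizeUpTo i : ZMod n) :=
    Finset.image_val_of_injOn (c.natCast_sizeUpTo_injective x).injOn
  conv_lhs => enter [2]; rw [hval]
  rw [Multiset.map_map]
  simp only [Function.comp_def, c.sInf_gap_cyclicSet]
  rw [Fin.univ_val_map, c.ofFn_blocksFun]

theorem Composition.mem_cyclicSet_self {n : ℕ} [NeZero n] (c : Composition n) (x : ZMod n) :
    x ∈ c.cyclicSet x := by
  simpa using (c.add_mem_cyclicSet x (Nat.zero_le n)).mpr ⟨0, c.sizeUpTo_zero⟩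

theorem Composition.cyclicSet_injective {n : ℕ} [NeZero n] (x : ZMod n) :
    Function.Injective fun c : Composition n => c.cyclicSet x := by
  intro c d h
  refine Composition.eq_of_sizeUpTo fun k hk => ?_
  rw [← c.add_mem_cyclicSet x hk, ← d.add_mem_cyclicSet x hk]
  exact iff_of_eq (congrArg (_ ∈ ·) h)

theorem Composition.exists_cyclicSet_eq {n : ℕ} [NeZero n] {x : ZMod n} {Q : Finset (ZMod n)}
    (hx : x ∈ Q) : ∃ c : Composition n, c.cyclicSet x = Q := by
  obtain ⟨c, hc⟩ := Composition.exists_sizeUpTo (n := n) (fun k => x + (k : ZMod n) ∈ Q)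
    (by simpa using hx) (by simpa using hx)
  refine ⟨c, Finset.ext fun y => ?_⟩
  have hy : y = x + ((y - x).val : ZMod n) := by simp
  have hle : (y - x).val ≤ n := (ZMod.val_lt _).le
  rw [hy, c.add_mem_cyclicSet x hle, hc _ hle]

open Finset in
/-- Let `1 ≤ s ≤ p` and let `B` be a multiset of `s` positive integers with sum `p`.
For a subset `Q` of `ℤ/pℤ` and `q ∈ Q`, the gap of `q` is the least `k` with
`1 ≤ k ≤ p` and `q + k ∈ Q`.  The number of subsets `Q` of `ℤ/pℤ` of cardinality `s`
whose multiset of gaps equals `B` is `p (s−1)! / ∏_v m_v!` (where `m_v` is the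
multiplicity of `v` in `B`); equivalently, this count times `∏_v m_v!` equals
`p (s−1)!`. -/
theorem card_subsets_with_gap_multiset (p s : ℕ) (hp : 1 ≤ p) (hs : 1 ≤ s) (hsp : s ≤ p)
    (B : Multiset ℕ) (hcard : Multiset.card B = s) (hpos : ∀ b ∈ B, 0 < b)
    (hsum : B.sum = p) :
    Nat.card {Q : Finset (ZMod p) // Q.card = s ∧
        Q.val.map (fun q => sInf {k : ℕ | 1 ≤ k ∧ k ≤ p ∧ q + (k : ZMod p) ∈ Q}) = B} *
      (B.toFinset.prod fun v => Nat.factorial (B.count v)) =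
    p * Nat.factorial (s - 1) := by
  classical
  have : NeZero p := ⟨by lia⟩
  let gaps (Q : Finset (ZMod p)) : Multiset ℕ :=
    Q.val.map (fun q => sInf {k : ℕ | 1 ≤ k ∧ k ≤ p ∧ q + (k : ZMod p) ∈ Q})
  set F : Finset (Finset (ZMod p)) := univ.filter fun Q => #Q = s ∧ gaps Q = B with hF
  have hN : Nat.card {Q : Finset (ZMod p) // Q.card = s ∧
      Q.val.map (fun q => sInf {k : ℕ | 1 ≤ k ∧ k ≤ p ∧ q + (k : ZMod p) ∈ Q}) = B} = #F := by
    rw [Nat.card_eq_fintype_card, Fintype.card_subtype]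
  have hcardF (x : ZMod p) : #{Q ∈ F | x ∈ Q} = #B.lists.toFinset := by
    symm
    have hB {l : List ℕ} (hl : l ∈ B.lists.toFinset) : B = l := by
      simpa [Multiset.mem_lists_iff] using hl
    let comp (l : List ℕ) (hl : l ∈ B.lists.toFinset) : Composition p :=
      ⟨l, fun {i} hi => hpos i (by rw [hB hl]; exact hi),
        by rw [← hsum, hB hl, Multiset.sum_coe]⟩
    refine card_bij (fun l hl => (comp l hl).cyclicSet x) ?_ ?_ ?_
    · intro l hl
      have hgaps : gaps ((comp l hl).cyclicSet x) = B :=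
        ((comp l hl).map_gap_cyclicSet x).trans (hB hl).symm
      simp only [hF, mem_filter, mem_univ, true_and]
      refine ⟨⟨?_, hgaps⟩, (comp l hl).mem_cyclicSet_self x⟩
      rw [← hcard, ← hgaps, Multiset.card_map, card_val]
    · intro l hl l' hl' h
      exact congrArg Composition.blocks (Composition.cyclicSet_injective x h)
    · intro Q hQ
      simp only [hF, mem_filter, mem_univ, true_and] at hQ
      obtain ⟨c, rfl⟩ := Composition.exists_cyclicSet_eq hQ.2
      refine ⟨c.blocks, ?_, rfl⟩
      rw [Multiset.mem_toFinset, Multiset.mem_lists_iff, ← hQ.1.2]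
      exact c.map_gap_cyclicSet x
  have hdouble : #F * s = p * #B.lists.toFinset := by
    have h := sum_card_bipartiteAbove_eq_sum_card_bipartiteBelow
      (s := F) (t := (univ : Finset (ZMod p))) (fun Q x => x ∈ Q)
    simp only [bipartiteAbove, bipartiteBelow, hcardF, filter_univ_mem, sum_const, card_univ,
      ZMod.card, smul_eq_mul] at h
    rw [← h, sum_const_nat]
    intro Q hQ
    exact (mem_filter.mp hQ).2.1
  have hlists := B.card_lists_toFinset_mul_prod_factorial
  rw [hcard] at hlists
  rw [hN]
  apply Nat.eq_of_mul_eq_mul_left hs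
  calc _ = #F * s * ∏ v ∈ B.toFinset, (B.count v).factorial := by ring
    _ = p * s.factorial := by rw [hdouble, mul_assoc, hlists]
    _ = _ := by rw [← Nat.mul_factorial_pred (by lia : s ≠ 0)]; ring
end

section
/- Let r ≥ 1 and let m_1, …, m_r be natural numbers with m := m_1 + ⋯ + m_r. Let σ be the uniform probability measure on the unit sphere {a ∈ ℂ^r : ‖a‖ = 1} of the hermitian space ℂ^r. Then ∫ |a_1|^{2m_1} · |a_2|^{2m_2} ⋯ |a_r|^{2m_r} dσ(a) = (r−1)! · m_1! · m_2! ⋯ m_r! / (r−1+m)!. -/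
open MeasureTheory

noncomputable instance (r : ℕ) : MeasurableSpace (EuclideanSpace ℂ (Fin r)) := borel _
instance (r : ℕ) : BorelSpace (EuclideanSpace ℂ (Fin r)) := ⟨rfl⟩

open Set Metric in
/-- Integration in polar coordinates of a homogeneous function times a radial weight. -/
theorem integral_mul_fun_norm_of_homogeneous {E : Type*} [NormedAddCommGroup E] [NormedSpace ℝ E]
    [MeasurableSpace E] [BorelSpace E] [FiniteDimensional ℝ E] [Nontrivial E]
    (μ : Measure E) [μ.IsAddHaarMeasure] {f : E → ℝ} {k : ℕ}
    (hf : ∀ t : ℝ, 0 < t → ∀ x, f (t • x) = t ^ k * f x) (g : ℝ → ℝ) :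
    ∫ x, f x * g ‖x‖ ∂μ =
      (∫ x : sphere (0 : E) 1, f x ∂μ.toSphere) *
        ∫ y in Ioi (0 : ℝ), y ^ (Module.finrank ℝ E - 1 + k) * g y := by
  calc
    ∫ x, f x * g ‖x‖ ∂μ = ∫ x : ({(0)}ᶜ : Set E), f x.1 * g ‖x.1‖ ∂(μ.comap (↑)) := by
      rw [integral_subtype_comap (measurableSet_singleton _).compl fun x ↦ f x * g ‖x‖,
        restrict_compl_singleton]
    _ = ∫ x : sphere (0 : E) 1 × Ioi (0 : ℝ), f x.1 * ((x.2 : ℝ) ^ k * g x.2)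
          ∂μ.toSphere.prod (.volumeIoiPow (Module.finrank ℝ E - 1)) := by
      rw [← μ.measurePreserving_homeomorphUnitSphereProd.integral_comp
        (Homeomorph.measurableEmbedding _)]
      refine integral_congr_ae (.of_forall fun x ↦ ?_)
      have hx : 0 < ‖x.1‖ := norm_pos_iff.2 x.2
      have h := hf ‖x.1‖ hx (‖x.1‖⁻¹ • x.1)
      rw [smul_inv_smul₀ hx.ne'] at h
      simp only [homeomorphUnitSphereProd_apply_fst_coe, homeomorphUnitSphereProd_apply_snd_coe]
      rw [h]
      ring
    _ = (∫ x : sphere (0 : E) 1, f x ∂μ.toSphere) *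
          ∫ y : Ioi (0 : ℝ), (y : ℝ) ^ k * g y ∂.volumeIoiPow (Module.finrank ℝ E - 1) :=
      integral_prod_mul (fun x : sphere (0 : E) 1 ↦ f x)
        (fun y : Ioi (0 : ℝ) ↦ (y : ℝ) ^ k * g y)
    _ = _ := by
      congr 1
      simp only [Measure.volumeIoiPow, ENNReal.ofReal]
      rw [integral_withDensity_eq_integral_smul,
        integral_subtype_comap measurableSet_Ioi
          fun a ↦ Real.toNNReal (a ^ (Module.finrank ℝ E - 1)) • (a ^ k * g a),
        setIntegral_congr_fun measurableSet_Ioi fun x hx ↦ ?_]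
      · rw [NNReal.smul_def, Real.coe_toNNReal _ (pow_nonneg hx.out.le _), smul_eq_mul]
        ring
      · exact (measurable_subtype_coe.pow_const _).real_toNNReal

theorem integral_pow_odd_mul_exp_neg_sq (n : ℕ) :
    ∫ y in Set.Ioi (0 : ℝ), y ^ (2 * n + 1) * Real.exp (-y ^ 2) = (Nat.factorial n : ℝ) / 2 := by
  have h := integral_rpow_mul_exp_neg_rpow (p := 2) (q := (2 * n + 1 : ℕ)) two_pos
    (by linarith [Nat.cast_nonneg (α := ℝ) (2 * n + 1)])
  simp only [Real.rpow_natCast, Real.rpow_two] at h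
  rw [h, ← Real.Gamma_nat_eq_factorial, show (((2 * n + 1 : ℕ) : ℝ) + 1) / 2 = n + 1 by
    push_cast; ring]
  ring

theorem integral_complex_norm_pow_mul_exp_neg_sq (n : ℕ) :
    ∫ z : ℂ, ‖z‖ ^ (2 * n) * Real.exp (-‖z‖ ^ 2) = Real.pi * Nat.factorial n := by
  have h := Complex.integral_rpow_mul_exp_neg_rpow (p := 2) (q := (2 * n : ℕ)) one_le_two
    (by linarith [Nat.cast_nonneg (α := ℝ) (2 * n)])
  simp only [Real.rpow_natCast, Real.rpow_two] at h
  rw [h, ← Real.Gamma_nat_eq_factorial, show (((2 * n : ℕ) : ℝ) + 2) / 2 = n + 1 by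
    push_cast; ring]
  ring

/-- Gaussian moments of `ℂ^r`, up to the normalization of the Haar measure. -/
theorem exists_integral_prod_pow_norm_mul_exp_neg_sq (r : ℕ)
    (μ : Measure (EuclideanSpace ℂ (Fin r))) [μ.IsAddHaarMeasure] :
    ∃ c : ℝ, c ≠ 0 ∧ ∀ m : Fin r → ℕ,
      ∫ x, (∏ i, ‖x i‖ ^ (2 * m i)) * Real.exp (-‖x‖ ^ 2) ∂μ =
        c * ∏ i, (Nat.factorial (m i) : ℝ) := by
  let e : (Fin r → ℂ) ≃L[ℝ] EuclideanSpace ℂ (Fin r) :=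
    (PiLp.continuousLinearEquiv 2 ℝ fun _ : Fin r ↦ ℂ).symm
  let ν : Measure (EuclideanSpace ℂ (Fin r)) := Measure.map e volume
  have he : MeasurableEmbedding e := e.toHomeomorph.measurableEmbedding
  have hν : ν.IsAddHaarMeasure := e.isAddHaarMeasure_map volume
  obtain ⟨c, hc, hμ⟩ : ∃ c : NNReal, c ≠ 0 ∧ μ = c • ν :=
    ⟨_, (Measure.addHaarScalarFactor_pos_of_isAddHaarMeasure μ ν).ne',
      Measure.isAddLeftInvariant_eq_smul μ ν⟩
  refine ⟨c * Real.pi ^ r, by positivity, fun m ↦ ?_⟩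
  rw [hμ, integral_smul_nnreal_measure, NNReal.smul_def, smul_eq_mul, mul_assoc,
    he.integral_map]
  congr 1
  calc
    _ = ∫ x : Fin r → ℂ, ∏ i, (‖x i‖ ^ (2 * m i) * Real.exp (-‖x i‖ ^ 2)) := by
      refine integral_congr_ae (.of_forall fun x ↦ ?_)
      have hn : ‖e x‖ ^ 2 = ∑ i, ‖x i‖ ^ 2 := EuclideanSpace.norm_sq_eq _
      have hx : ∀ i, e x i = x i := fun _ ↦ rfl
      change (∏ i, ‖e x i‖ ^ (2 * m i)) * Real.exp (-‖e x‖ ^ 2) = _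
      simp only [hn, hx]
      rw [Finset.prod_mul_distrib, ← Real.exp_sum, Finset.sum_neg_distrib]
    _ = ∏ i, (Real.pi * (Nat.factorial (m i) : ℝ)) := by
      rw [integral_fintype_prod_volume_eq_prod
        (fun i (z : ℂ) ↦ ‖z‖ ^ (2 * m i) * Real.exp (-‖z‖ ^ 2))]
      simp only [integral_complex_norm_pow_mul_exp_neg_sq]
    _ = _ := by simp [Finset.prod_mul_distrib]

/-- Unnormalized moments on the unit sphere of `ℂ^r`. -/
theorem exists_integral_toSphere_prod_pow_norm (r : ℕ) (hr : 1 ≤ r)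
    (μ : Measure (EuclideanSpace ℂ (Fin r))) [μ.IsAddHaarMeasure] :
    ∃ c : ℝ, c ≠ 0 ∧ ∀ m : Fin r → ℕ,
      ∫ a : Metric.sphere (0 : EuclideanSpace ℂ (Fin r)) 1,
          ∏ i, ‖(a : EuclideanSpace ℂ (Fin r)) i‖ ^ (2 * m i) ∂μ.toSphere =
        c * (∏ i, (Nat.factorial (m i) : ℝ)) / (Nat.factorial (r - 1 + ∑ i, m i) : ℝ) := by
  have : Nonempty (Fin r) := ⟨⟨0, hr⟩⟩
  have hdim : Module.finrank ℝ (EuclideanSpace ℂ (Fin r)) = 2 * r := by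
    rw [← Module.finrank_mul_finrank ℝ ℂ, Complex.finrank_real_complex, finrank_euclideanSpace_fin]
  obtain ⟨c, hc, h⟩ := exists_integral_prod_pow_norm_mul_exp_neg_sq r μ
  refine ⟨2 * c, by positivity, fun m ↦ ?_⟩
  have hpolar := integral_mul_fun_norm_of_homogeneous μ (k := 2 * ∑ i, m i)
    (f := fun x : EuclideanSpace ℂ (Fin r) ↦ ∏ i, ‖x i‖ ^ (2 * m i))
    (fun t ht x ↦ by
      simp [mul_pow, Finset.prod_mul_distrib, Finset.prod_pow_eq_pow_sum,
        Finset.mul_sum, abs_of_pos ht]) (fun y ↦ Real.exp (-y ^ 2))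
  rw [h, hdim, show 2 * r - 1 + 2 * ∑ i, m i = 2 * (r - 1 + ∑ i, m i) + 1 by omega,
    integral_pow_odd_mul_exp_neg_sq] at hpolar
  rw [eq_div_iff (by positivity)]
  linarith

/-- Moments of coordinates on the unit sphere of `ℂ^r`: with respect to the uniform
probability measure `σ` on the unit sphere of the hermitian space `ℂ^r` (the normalized
spherical measure, obtained from Haar–Lebesgue measure via `Measure.toSphere`),
`∫ |a_1|^{2m_1} ⋯ |a_r|^{2m_r} dσ(a) = (r−1)! m_1! ⋯ m_r! / (r−1+m)!` where
`m = m_1 + ⋯ + m_r`. -/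
theorem integral_sphere_prod_pow_abs (r : ℕ) (hr : 1 ≤ r) (m : Fin r → ℕ) :
    (∫ a : Metric.sphere (0 : EuclideanSpace ℂ (Fin r)) 1,
        ∏ i : Fin r, ‖(a : EuclideanSpace ℂ (Fin r)) i‖ ^ (2 * m i)
        ∂(((Measure.addHaar : Measure (EuclideanSpace ℂ (Fin r))).toSphere Set.univ)⁻¹ •
            (Measure.addHaar : Measure (EuclideanSpace ℂ (Fin r))).toSphere)) =
      ((Nat.factorial (r - 1) : ℝ) * ∏ i : Fin r, (Nat.factorial (m i) : ℝ)) /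
        (Nat.factorial (r - 1 + ∑ i : Fin r, m i) : ℝ) := by
  obtain ⟨c, hc, h⟩ := exists_integral_toSphere_prod_pow_norm r hr
    (Measure.addHaar : Measure (EuclideanSpace ℂ (Fin r)))
  have h0 := h 0
  simp only [Pi.zero_apply, mul_zero, pow_zero, Finset.prod_const_one, integral_const, smul_eq_mul,
    mul_one, Nat.factorial_zero, Nat.cast_one, Finset.sum_const_zero, add_zero] at h0
  rw [integral_smul_measure, h, ENNReal.toReal_inv, ← measureReal_def, h0, smul_eq_mul]
  field_simp
end

section
/- Let r ≥ 1, let M be an r × r complex matrix, and let m ≥ 0 be an integer. Let σ be the uniform probability measure on the unit sphere {a ∈ ℂ^r : ‖a‖ = 1}. Then ∫ ( ∑_{i,j} M_{i,j} · a_j · conj(a_i) )^m dσ(a) = ( (r−1)! / (r−1+m)! ) · ∑_{i : Fin m → Fin r} ∑_{τ ∈ Perm(Fin m)} ∏_{a} M (i a) (i (τ a)). -/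
open MeasureTheory

theorem card_perm_comp_eq {α κ : Type*} [Fintype α] [DecidableEq α] [Fintype κ] [DecidableEq κ]
    (i j : α → κ) :
    Fintype.card {τ : Equiv.Perm α // j = i ∘ τ} =
      ∏ k, if Fintype.card {a // j a = k} = Fintype.card {a // i a = k} then
        (Fintype.card {a // j a = k}).factorial else 0 := by
  by_cases h : ∀ k, Fintype.card {a // j a = k} = Fintype.card {a // i a = k}
  · let τ₀ : Equiv.Perm α := Equiv.ofFiberEquiv fun k ↦ Fintype.equivOfCardEq (h k)
    have hτ₀ : i ∘ τ₀ = j := funext fun a ↦ Equiv.ofFiberEquiv_map _ a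
    have key : ∀ τ : Equiv.Perm α, i ∘ τ = i ↔ j = i ∘ (τ * τ₀) := by
      intro τ
      rw [Equiv.Perm.coe_mul, ← Function.comp_assoc, ← hτ₀]
      constructor
      · intro h; rw [h]
      · intro h; exact (τ₀.surjective.injective_comp_right h).symm
    rw [← Fintype.card_congr ((Equiv.mulRight τ₀).subtypeEquiv key),
      DomMulAct.stabilizer_card]
    simp only [h, if_true]
  · push Not at h
    obtain ⟨k, hk⟩ := h
    rw [Finset.prod_eq_zero (Finset.mem_univ k) (if_neg hk), Fintype.card_eq_zero_iff]
    refine ⟨fun ⟨τ, hτ⟩ ↦ hk (Fintype.card_congr (τ.subtypeEquiv fun a ↦ ?_))⟩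
    rw [hτ, Function.comp_apply]

theorem integral_norm_pow_mul_exp_neg_sq (n : ℕ) :
    ∫ z : ℂ, ‖z‖ ^ n * Real.exp (-‖z‖ ^ 2) = Real.pi * Real.Gamma ((n + 2) / 2) := by
  have := Complex.integral_rpow_mul_exp_neg_rpow (p := 2) (q := n) (by norm_num)
    (by linarith [n.cast_nonneg (α := ℝ)])
  norm_cast at this
  rw [mul_div_cancel_left₀ _ (two_ne_zero' ℝ)] at this
  simpa using this

theorem integrable_monomial_mul_exp_neg_sq (n p : ℕ) :
    Integrable fun z : ℂ ↦
      z ^ n * (starRingEnd ℂ) z ^ p * (Real.exp (-‖z‖ ^ 2) : ℂ) := by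
  have h : Integrable fun z : ℂ ↦ ‖z‖ ^ (n + p) * Real.exp (-‖z‖ ^ 2) := by
    refine not_imp_comm.1 integral_undef ?_
    rw [integral_norm_pow_mul_exp_neg_sq]
    exact mul_ne_zero Real.pi_ne_zero (Real.Gamma_pos_of_pos (by positivity)).ne'
  refine h.mono' (by fun_prop) (.of_forall fun z ↦ ?_)
  simp [-Complex.ofReal_exp, pow_add, abs_of_pos, Real.exp_pos]

theorem integral_monomial_mul_exp_neg_sq (n p : ℕ) :
    ∫ z : ℂ, z ^ n * (starRingEnd ℂ) z ^ p * (Real.exp (-‖z‖ ^ 2) : ℂ) =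
      Real.pi * ((if n = p then n.factorial else 0 : ℕ) : ℂ) := by
  split_ifs with h
  · subst h
    have : ∀ z : ℂ, z ^ n * (starRingEnd ℂ) z ^ n * (Real.exp (-‖z‖ ^ 2) : ℂ) =
        ((‖z‖ ^ (2 * n) * Real.exp (-‖z‖ ^ 2) : ℝ) : ℂ) := by
      intro z
      rw [← mul_pow, Complex.mul_conj, Complex.normSq_eq_norm_sq, pow_mul]
      push_cast
      ring
    simp_rw [this]
    rw [integral_complex_ofReal, integral_norm_pow_mul_exp_neg_sq,
      show ((2 * n : ℕ) + 2 : ℝ) / 2 = n + 1 by push_cast; ring, Real.Gamma_nat_eq_factorial]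
    push_cast
    ring
  · have hnp : (n : ℂ) - p ≠ 0 := sub_ne_zero.2 (by exact_mod_cast h)
    set c : Circle := Circle.exp (Real.pi / (n - p)) with hc
    have hcc : (c : ℂ) ^ n * (starRingEnd ℂ) (c : ℂ) ^ p = -1 := by
      rw [← Circle.coe_inv_eq_conj, hc, ← Circle.exp_neg, Circle.coe_exp, Circle.coe_exp,
        ← Complex.exp_nat_mul, ← Complex.exp_nat_mul, ← Complex.exp_add, ← Complex.exp_pi_mul_I]
      congr 1
      push_cast
      field_simp
      ring
    have key := (rotation c).measurePreserving.integral_comp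
      (rotation c).toHomeomorph.measurableEmbedding
      (fun z : ℂ ↦ z ^ n * (starRingEnd ℂ) z ^ p * (Real.exp (-‖z‖ ^ 2) : ℂ))
    have : ∀ z : ℂ, (rotation c z) ^ n * (starRingEnd ℂ) (rotation c z) ^ p *
        (Real.exp (-‖rotation c z‖ ^ 2) : ℂ) =
        (-1) * (z ^ n * (starRingEnd ℂ) z ^ p * (Real.exp (-‖z‖ ^ 2) : ℂ)) := by
      intro z
      rw [← hcc, LinearIsometryEquiv.norm_map, rotation_apply, map_mul]
      ring
    simp_rw [this] at key
    rw [integral_const_mul] at key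
    rw [Nat.cast_zero, mul_zero]
    linear_combination (-1 / 2 : ℂ) * key

theorem prod_comp_eq_prod_pow_card {α κ R : Type*} [Fintype α] [Fintype κ]
    [DecidableEq κ] [CommMonoid R] (i : α → κ) (f : κ → R) :
    ∏ a, f (i a) = ∏ k, f k ^ Fintype.card {a // i a = k} := by
  rw [← Fintype.prod_fiberwise i]
  refine Finset.prod_congr rfl fun k _ ↦ ?_
  rw [Finset.prod_congr rfl fun a _ ↦ by rw [a.2], Finset.prod_const, Finset.card_univ]

theorem monomial_mul_gaussian_eq_prod {r m : ℕ} (i j : Fin m → Fin r) (z : Fin r → ℂ) :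
    (∏ a, z (j a) * (starRingEnd ℂ) (z (i a))) * (Real.exp (-∑ k, ‖z k‖ ^ 2) : ℂ) =
      ∏ k, z k ^ Fintype.card {a // j a = k} *
        (starRingEnd ℂ) (z k) ^ Fintype.card {a // i a = k} * (Real.exp (-‖z k‖ ^ 2) : ℂ) := by
  rw [Finset.prod_mul_distrib, prod_comp_eq_prod_pow_card j z,
    prod_comp_eq_prod_pow_card i fun k ↦ (starRingEnd ℂ) (z k), Finset.prod_mul_distrib,
    Finset.prod_mul_distrib, ← Finset.sum_neg_distrib, Real.exp_sum, Complex.ofReal_prod]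

theorem integrable_monomial_mul_gaussian {r m : ℕ} (i j : Fin m → Fin r) :
    Integrable fun z : Fin r → ℂ ↦
      (∏ a, z (j a) * (starRingEnd ℂ) (z (i a))) * (Real.exp (-∑ k, ‖z k‖ ^ 2) : ℂ) := by
  simp_rw [monomial_mul_gaussian_eq_prod]
  exact Integrable.fintype_prod (μ := fun _ ↦ volume) (f := fun k (w : ℂ) ↦
    w ^ Fintype.card {a // j a = k} * (starRingEnd ℂ) w ^ Fintype.card {a // i a = k} *
      (Real.exp (-‖w‖ ^ 2) : ℂ)) fun k ↦ integrable_monomial_mul_exp_neg_sq _ _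

theorem integral_monomial_mul_gaussian {r m : ℕ} (i j : Fin m → Fin r) :
    ∫ z : Fin r → ℂ,
      (∏ a, z (j a) * (starRingEnd ℂ) (z (i a))) * (Real.exp (-∑ k, ‖z k‖ ^ 2) : ℂ) =
      Real.pi ^ r * ∑ τ : Equiv.Perm (Fin m), if j = i ∘ τ then 1 else 0 := by
  simp_rw [monomial_mul_gaussian_eq_prod]
  rw [integral_fintype_prod_volume_eq_prod (fun k (w : ℂ) ↦
    w ^ Fintype.card {a // j a = k} * (starRingEnd ℂ) w ^ Fintype.card {a // i a = k} *
      (Real.exp (-‖w‖ ^ 2) : ℂ))]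
  simp_rw [integral_monomial_mul_exp_neg_sq]
  rw [Finset.prod_mul_distrib, ← Nat.cast_prod, ← card_perm_comp_eq, Finset.sum_boole,
    Fintype.card_subtype]
  simp

theorem quadratic_pow_eq_sum {r : ℕ} (M : Matrix (Fin r) (Fin r) ℂ) (m : ℕ) (z : Fin r → ℂ) :
    (∑ i, ∑ j, M i j * z j * (starRingEnd ℂ) (z i)) ^ m =
      ∑ i : Fin m → Fin r, ∑ j : Fin m → Fin r,
        (∏ a, M (i a) (j a)) * ∏ a, z (j a) * (starRingEnd ℂ) (z (i a)) := by
  rw [Fintype.sum_pow]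
  refine Finset.sum_congr rfl fun i _ ↦ ?_
  rw [Finset.prod_univ_sum, Fintype.piFinset_univ]
  refine Finset.sum_congr rfl fun j _ ↦ ?_
  rw [← Finset.prod_mul_distrib]
  exact Finset.prod_congr rfl fun a _ ↦ mul_assoc _ _ _

theorem integral_quadratic_pow_mul_gaussian {r : ℕ} (M : Matrix (Fin r) (Fin r) ℂ) (m : ℕ) :
    ∫ z : Fin r → ℂ, (∑ i, ∑ j, M i j * z j * (starRingEnd ℂ) (z i)) ^ m *
        (Real.exp (-∑ k, ‖z k‖ ^ 2) : ℂ) =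
      Real.pi ^ r * ∑ i : Fin m → Fin r, ∑ τ : Equiv.Perm (Fin m), ∏ a, M (i a) (i (τ a)) := by
  simp_rw [quadratic_pow_eq_sum, Finset.sum_mul, mul_assoc (∏ a, M _ _)]
  have hint (i j : Fin m → Fin r) := (integrable_monomial_mul_gaussian i j).const_mul
    (∏ a, M (i a) (j a))
  rw [integral_finsetSum _ fun i _ ↦ integrable_finsetSum _ fun j _ ↦ hint i j, Finset.mul_sum]
  refine Finset.sum_congr rfl fun i _ ↦ ?_
  rw [integral_finsetSum _ fun j _ ↦ hint i j]
  simp_rw [integral_const_mul, integral_monomial_mul_gaussian, Finset.mul_sum]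
  rw [Finset.sum_comm]
  refine Finset.sum_congr rfl fun τ _ ↦ ?_
  simp [mul_comm]

theorem integral_homogeneous_mul_gaussian {E : Type*} [NormedAddCommGroup E] [NormedSpace ℝ E]
    [FiniteDimensional ℝ E] [MeasurableSpace E] [BorelSpace E] [Nontrivial E]
    (μ : Measure E) [μ.IsAddHaarMeasure] (f : E → ℂ) (n : ℕ)
    (hf : ∀ (t : ℝ) (x : E), 0 < t → f (t • x) = (t : ℂ) ^ n * f x) :
    ∫ x, f x * (Real.exp (-‖x‖ ^ 2) : ℂ) ∂μ =
      (∫ x : Metric.sphere (0 : E) 1, f x ∂μ.toSphere) *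
        ((Real.Gamma ((Module.finrank ℝ E + n : ℕ) / 2) / 2 : ℝ) : ℂ) := by
  have hdim : 0 < Module.finrank ℝ E := Module.finrank_pos
  have hrad : ∫ t : Set.Ioi (0 : ℝ), (t : ℂ) ^ n * (Real.exp (-(t : ℝ) ^ 2) : ℂ)
      ∂.volumeIoiPow (Module.finrank ℝ E - 1) =
      ((Real.Gamma ((Module.finrank ℝ E + n : ℕ) / 2) / 2 : ℝ) : ℂ) := by
    have := integral_rpow_mul_exp_neg_rpow (p := 2) (q := (Module.finrank ℝ E - 1 + n : ℕ))
      (by norm_num) (lt_of_lt_of_le (by norm_num) (Nat.cast_nonneg _))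
    rw [show (((Module.finrank ℝ E - 1 + n : ℕ) : ℝ) + 1) = (Module.finrank ℝ E + n : ℕ) by
      norm_cast; omega, one_div_mul_eq_div] at this
    rw [← this, ← integral_complex_ofReal]
    simp only [Measure.volumeIoiPow, ENNReal.ofReal]
    rw [integral_withDensity_eq_integral_smul
        ((measurable_subtype_coe.pow_const _).real_toNNReal),
      integral_subtype_comap measurableSet_Ioi fun a : ℝ ↦
        Real.toNNReal (a ^ (Module.finrank ℝ E - 1)) • ((a : ℂ) ^ n * (Real.exp (-a ^ 2) : ℂ))]
    refine setIntegral_congr_fun measurableSet_Ioi fun x hx ↦ ?_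
    simp only [NNReal.smul_def, Real.coe_toNNReal _ (pow_nonneg (Set.mem_Ioi.1 hx).le _)]
    rw [Complex.real_smul, Real.rpow_natCast, Real.rpow_two]
    push_cast
    ring
  calc
    ∫ x, f x * (Real.exp (-‖x‖ ^ 2) : ℂ) ∂μ
      = ∫ x : ({(0)}ᶜ : Set E), f x.1 * (Real.exp (-‖x.1‖ ^ 2) : ℂ) ∂(μ.comap (↑)) := by
      rw [integral_subtype_comap (measurableSet_singleton _).compl
        fun x ↦ f x * (Real.exp (-‖x‖ ^ 2) : ℂ), restrict_compl_singleton]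
    _ = ∫ x, f x.1 * ((x.2 : ℂ) ^ n * (Real.exp (-(x.2 : ℝ) ^ 2) : ℂ))
          ∂μ.toSphere.prod (.volumeIoiPow (Module.finrank ℝ E - 1)) := by
      rw [← μ.measurePreserving_homeomorphUnitSphereProd.integral_comp
        (Homeomorph.measurableEmbedding _)]
      refine integral_congr_ae (.of_forall fun x ↦ ?_)
      have hx : 0 < ‖x.1‖ := norm_pos_iff.2 x.2
      have := hf ‖x.1‖ (‖x.1‖⁻¹ • x.1) hx
      rw [smul_inv_smul₀ hx.ne'] at this
      simp only [homeomorphUnitSphereProd_apply_fst_coe, homeomorphUnitSphereProd_apply_snd_coe]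
      rw [this]
      ring
    _ = _ := by
      rw [integral_prod_mul (fun x : Metric.sphere (0 : E) 1 ↦ f x)
        (fun t : Set.Ioi (0 : ℝ) ↦ (t : ℂ) ^ n * (Real.exp (-(t : ℝ) ^ 2) : ℂ)), hrad]

theorem exists_addHaar_integral_eq (r : ℕ) : ∃ c : ℂ, c ≠ 0 ∧ ∀ f : (Fin r → ℂ) → ℂ,
    ∫ x : EuclideanSpace ℂ (Fin r), f x ∂Measure.addHaar = c * ∫ z, f z := by
  let e : EuclideanSpace ℂ (Fin r) ≃L[ℂ] (Fin r → ℂ) := EuclideanSpace.equiv (Fin r) ℂ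
  let ν := (Measure.addHaar : Measure (EuclideanSpace ℂ (Fin r))).map e
  have : ν.IsAddHaarMeasure := e.isAddHaarMeasure_map _
  refine ⟨((ν.addHaarScalarFactor volume : ℝ) : ℂ), ?_, fun f ↦ ?_⟩
  · exact_mod_cast (Measure.addHaarScalarFactor_pos_of_isAddHaarMeasure ν volume).ne'
  · have h : ∫ x, f (e x) ∂Measure.addHaar = ∫ z, f z ∂ν :=
      (e.toHomeomorph.measurableEmbedding.integral_map f).symm
    rw [Measure.isAddLeftInvariant_eq_smul ν volume, integral_smul_nnreal_measure] at h
    rw [NNReal.smul_def, Complex.real_smul] at h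
    exact h

theorem integral_sphere_quadratic_pow_mul_factorial (r : ℕ) (hr : 1 ≤ r) : ∃ c : ℂ, c ≠ 0 ∧
    ∀ (M : Matrix (Fin r) (Fin r) ℂ) (m : ℕ),
    (∫ a : Metric.sphere (0 : EuclideanSpace ℂ (Fin r)) 1,
        (∑ i : Fin r, ∑ j : Fin r,
            M i j * (a : EuclideanSpace ℂ (Fin r)) j *
              (starRingEnd ℂ) ((a : EuclideanSpace ℂ (Fin r)) i)) ^ m
        ∂(Measure.addHaar : Measure (EuclideanSpace ℂ (Fin r))).toSphere) *
      (r - 1 + m).factorial =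
    c * ∑ i : Fin m → Fin r, ∑ τ : Equiv.Perm (Fin m), ∏ a, M (i a) (i (τ a)) := by
  obtain ⟨c, hc, h⟩ := exists_addHaar_integral_eq r
  refine ⟨2 * c * Real.pi ^ r, by simp [hc, Real.pi_ne_zero], fun M m ↦ ?_⟩
  have : Nonempty (Fin r) := ⟨⟨0, hr⟩⟩
  have hpolar := integral_homogeneous_mul_gaussian
    (Measure.addHaar : Measure (EuclideanSpace ℂ (Fin r)))
    (fun x ↦ (∑ i, ∑ j, M i j * x j * (starRingEnd ℂ) (x i)) ^ m) (2 * m) (by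
      intro t x _
      simp only [PiLp.smul_apply, Complex.real_smul, map_mul, Complex.conj_ofReal]
      rw [pow_mul, ← mul_pow, Finset.mul_sum]
      congr 1
      refine Finset.sum_congr rfl fun i _ ↦ ?_
      rw [Finset.mul_sum]
      exact Finset.sum_congr rfl fun j _ ↦ by ring)
  have hdim : Module.finrank ℝ (EuclideanSpace ℂ (Fin r)) = 2 * r := by
    rw [← Module.finrank_mul_finrank ℝ ℂ, Complex.finrank_real_complex,
      finrank_euclideanSpace_fin]
  rw [hdim, show ((2 * r + 2 * m : ℕ) : ℝ) / 2 = (r - 1 + m : ℕ) + 1 by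
    rw [Nat.cast_add (r - 1), Nat.cast_sub hr]; push_cast; ring,
    Real.Gamma_nat_eq_factorial] at hpolar
  have hgauss := h fun z ↦ (∑ i, ∑ j, M i j * z j * (starRingEnd ℂ) (z i)) ^ m *
        (Real.exp (-∑ k, ‖z k‖ ^ 2) : ℂ)
  rw [integral_quadratic_pow_mul_gaussian] at hgauss
  simp_rw [EuclideanSpace.norm_sq_eq] at hpolar
  rw [hpolar] at hgauss
  push_cast at hgauss
  linear_combination 2 * hgauss

/-- Spherical moments of the quadratic form `⟨Ma,a⟩`: with respect to the uniform
probability measure on the unit sphere of `ℂ^r` (the normalized spherical measure,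
obtained from Haar–Lebesgue measure via `Measure.toSphere`), for every `r × r` complex
matrix `M` and every `m ≥ 0`,
`∫ (∑_{i,j} M_{ij} a_j conj(a_i))^m dσ(a)
  = ((r−1)!/(r−1+m)!) ∑_{i : Fin m → Fin r} ∑_{τ ∈ Perm(Fin m)} ∏_a M (i a) (i (τ a))`. -/
theorem integral_sphere_pow_quadratic (r : ℕ) (hr : 1 ≤ r)
    (M : Matrix (Fin r) (Fin r) ℂ) (m : ℕ) :
    (∫ a : Metric.sphere (0 : EuclideanSpace ℂ (Fin r)) 1,
        (∑ i : Fin r, ∑ j : Fin r,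
            M i j * (a : EuclideanSpace ℂ (Fin r)) j *
              (starRingEnd ℂ) ((a : EuclideanSpace ℂ (Fin r)) i)) ^ m
        ∂(((Measure.addHaar : Measure (EuclideanSpace ℂ (Fin r))).toSphere Set.univ)⁻¹ •
            (Measure.addHaar : Measure (EuclideanSpace ℂ (Fin r))).toSphere)) =
      ((Nat.factorial (r - 1) : ℂ) / (Nat.factorial (r - 1 + m) : ℂ)) *
        ∑ i : Fin m → Fin r, ∑ τ : Equiv.Perm (Fin m),
          ∏ a : Fin m, M (i a) (i (τ a)) := by
  obtain ⟨c, hc, h⟩ := integral_sphere_quadratic_pow_mul_factorial r hr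
  have h₀ := h 0 0
  have hm := h M m
  simp only [pow_zero, integral_const, Finset.univ_eq_empty, Finset.prod_empty, Finset.sum_const,
    Finset.card_univ, Fintype.card_unique, add_zero, mul_one, one_smul, Complex.real_smul,
    Measure.real] at h₀
  have hfac (n : ℕ) : (n.factorial : ℂ) ≠ 0 := by exact_mod_cast n.factorial_ne_zero
  rw [integral_smul_measure, ENNReal.toReal_inv, Complex.real_smul, Complex.ofReal_inv]
  generalize ((Measure.addHaar : Measure (EuclideanSpace ℂ (Fin r))).toSphere Set.univ).toReal = V at *
  have hV : (V : ℂ) ≠ 0 := fun hV ↦ hc (by rw [← h₀, hV, zero_mul])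
  rw [eq_div_of_mul_eq (hfac _) hm, ← h₀]
  field_simp
end
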